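/- For every integer p ≥ 1 and every θ ∈ (0,π), the function t ↦ (deriv C_p)(t) / M_p(t) is differentiable at θ and its derivative at θ is strictly positive; in particular t ↦ C_p′(t)/M_p(t) is strictly increasing on (0,π). -/

import Mathlib

/-- `C_p(θ) = -(2-2cos θ)^{p+1} · ∑_{j∈ℤ} (θ+2πj)^{-(2p+1)}`. -/
noncomputable def Cp (p : ℕ) (θ : ℝ) : ℝ :=
  -(2 - 2 * Real.cos θ) ^ (p + 1) *
    ∑' j : ℤ, ((θ + 2 * Real.pi * (j : ℝ)) ^ (2 * p + 1))⁻¹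

/-- `M_p(θ) = (2-2cos θ)^{p+1} · ∑_{j∈ℤ} (θ+2πj)^{-(2p+2)}`. -/
noncomputable def Mp (p : ℕ) (θ : ℝ) : ℝ :=
  (2 - 2 * Real.cos θ) ^ (p + 1) *
    ∑' j : ℤ, ((θ + 2 * Real.pi * (j : ℝ)) ^ (2 * p + 2))⁻¹

open Polynomial in
/-- The derivative polynomials of the cotangent: `derivPoly k` evaluated at `cot x` is
`(-1) ^ k` times the `k`-th derivative of `cot` at `x`. -/
noncomputable def derivPoly : ℕ → ℝ[X]
  | 0 => X
  | k + 1 => (1 + X ^ 2) * derivative (derivPoly k)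

open Polynomial in
lemma natDegree_derivPoly (k : ℕ) : (derivPoly k).natDegree = k + 1 := by
  induction k with
  | zero => simp [derivPoly]
  | succ k ih =>
    have hd : (derivative (derivPoly k)).natDegree = k := by
      have := degree_derivative (p := derivPoly k) (by rw [ih]; omega)
      rw [ih] at this
      exact natDegree_eq_of_degree_eq_some this
    have hne : derivative (derivPoly k) ≠ 0 := by
      intro h
      have := derivative_eq_zero.mp h
      omega
    have hq : (1 + X ^ 2 : ℝ[X]).natDegree = 2 := by compute_degree!
    have hq0 : (1 + X ^ 2 : ℝ[X]) ≠ 0 := by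
      intro h
      simp [h] at hq
    rw [derivPoly, natDegree_mul hq0 hne, hq, hd]
    ring

open Polynomial in
lemma derivPoly_ne_zero (k : ℕ) : derivPoly k ≠ 0 := by
  intro h
  have := natDegree_derivPoly k
  simp [h] at this

open Polynomial in
lemma derivPoly_comp_neg (k : ℕ) : (derivPoly k).comp (-X) = (-1) ^ (k + 1) * derivPoly k := by
  induction k with
  | zero => simp [derivPoly]
  | succ k ih =>
    have h := congrArg derivative ih
    have hc : ((-1 : ℝ[X]) ^ (k + 1)) = C ((-1) ^ (k + 1)) := by simp
    rw [derivative_comp, hc, derivative_C_mul, ← hc] at h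
    simp only [derivative_neg, derivative_X] at h
    simp only [derivPoly, mul_comp, add_comp, one_comp, pow_comp, X_comp]
    linear_combination (-1 - X ^ 2) * h

open Polynomial in
lemma eval_zero_derivPoly_two_mul (p : ℕ) : (derivPoly (2 * p)).eval 0 = 0 := by
  have h := congrArg (eval 0) (derivPoly_comp_neg (2 * p))
  simp [eval_comp, pow_succ, pow_mul] at h
  linarith

lemma convex_imaginary_segment : Convex ℝ {z : ℂ | z.re = 0 ∧ z.im ^ 2 ≤ 1} := by
  rintro x ⟨hx, hx'⟩ y ⟨hy, hy'⟩ a b ha hb hab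
  refine ⟨by simp [hx, hy], ?_⟩
  rw [sq_le_one_iff_abs_le_one, abs_le] at *
  simp only [Complex.add_im, Complex.real_smul, Complex.mul_im, Complex.ofReal_re,
    Complex.ofReal_im, zero_mul, add_zero]
  constructor <;> nlinarith

open Polynomial in
lemma roots_derivPoly (k : ℕ) :
    ∀ z ∈ ((derivPoly k).map Complex.ofRealHom).roots, z.re = 0 ∧ z.im ^ 2 ≤ 1 := by
  induction k with
  | zero => simp [derivPoly]
  | succ k ih =>
    intro z hz
    have hz0 := (mem_roots'.mp hz).2
    simp only [derivPoly, IsRoot.def, Polynomial.map_mul, eval_mul, mul_eq_zero] at hz0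
    rcases hz0 with h | h
    · simp only [Polynomial.map_add, Polynomial.map_one, Polynomial.map_pow, map_X, eval_add,
        eval_one, eval_pow, eval_X] at h
      have : (z - Complex.I) * (z + Complex.I) = 0 := by
        linear_combination h - Complex.I_sq
      rcases mul_eq_zero.mp this with h | h
      · rw [sub_eq_zero.mp h]; simp
      · rw [eq_neg_of_add_eq_zero_left h]; simp
    · have hdeg : 0 < ((derivPoly k).map Complex.ofRealHom).degree := by
        rw [degree_map, ← natDegree_pos_iff_degree_pos, natDegree_derivPoly]
        omega
      rw [← derivative_map] at h
      have hmem : z ∈ (derivative ((derivPoly k).map Complex.ofRealHom)).rootSet ℂ := by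
        rw [mem_rootSet]
        refine ⟨?_, by simpa using h⟩
        intro h0
        have := derivative_eq_zero.mp h0
        rw [natDegree_map, natDegree_derivPoly] at this
        omega
      refine convexHull_min ?_ convex_imaginary_segment
        (rootSet_derivative_subset_convexHull_rootSet hdeg hmem)
      intro w hw
      rw [mem_rootSet] at hw
      exact ih w (mem_roots'.mpr ⟨hw.1, by simpa using hw.2⟩)

/-- The imaginary parts of the (purely imaginary) roots of `derivPoly k`. -/
noncomputable def imagRoots (k : ℕ) : Multiset ℝ :=
  ((derivPoly k).map Complex.ofRealHom).roots.map Complex.im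

lemma sq_le_one_of_mem_imagRoots {k : ℕ} {s : ℝ} (hs : s ∈ imagRoots k) : s ^ 2 ≤ 1 := by
  obtain ⟨z, hz, rfl⟩ := Multiset.mem_map.mp hs
  exact (roots_derivPoly k z hz).2

open Polynomial in
lemma zero_mem_imagRoots (p : ℕ) : 0 ∈ imagRoots (2 * p) := by
  refine Multiset.mem_map.mpr ⟨0, ?_, by simp⟩
  rw [mem_roots', Polynomial.map_ne_zero_iff Complex.ofRealHom.injective]
  refine ⟨derivPoly_ne_zero _, ?_⟩
  have := eval_map_apply (f := Complex.ofRealHom) (p := derivPoly (2 * p)) (0 : ℝ)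
  rw [eval_zero_derivPoly_two_mul] at this
  simpa using this

open Polynomial in
lemma eval_derivPoly_ne_zero (k : ℕ) {c : ℝ} (hc : 0 < c) : (derivPoly k).eval c ≠ 0 := by
  intro h
  have := eval_map_apply (f := Complex.ofRealHom) (p := derivPoly k) c
  rw [h, map_zero] at this
  have := roots_derivPoly k _ (mem_roots'.mpr
    ⟨(Polynomial.map_ne_zero_iff Complex.ofRealHom.injective).mpr (derivPoly_ne_zero k), this⟩)
  simp at this
  linarith

open Polynomial in
lemma logDeriv_derivPoly (k : ℕ) {c : ℝ} (hc : 0 < c) :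
    (derivative (derivPoly k)).eval c / (derivPoly k).eval c =
      ((imagRoots k).map fun s => c / (c ^ 2 + s ^ 2)).sum := by
  set P := (derivPoly k).map Complex.ofRealHom with hP
  have h1 := eval_map_apply (f := Complex.ofRealHom) (p := derivPoly k) c
  have h2 := eval_map_apply (f := Complex.ofRealHom) (p := derivative (derivPoly k)) c
  have h0 : P.eval (c : ℂ) ≠ 0 := by
    have := eval_derivPoly_ne_zero k hc
    simp only [Complex.ofRealHom_eq_coe] at h1
    rw [hP, h1]
    exact_mod_cast this
  have h := (IsAlgClosed.splits P).eval_derivative_div_eval_of_ne_zero h0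
  simp only [Complex.ofRealHom_eq_coe] at h1 h2
  rw [hP, derivative_map, h1, h2, ← Complex.ofReal_div] at h
  have h' := congrArg Complex.reAddGroupHom h
  rw [map_multiset_sum, Multiset.map_map] at h'
  rw [imagRoots, Multiset.map_map]
  refine Eq.trans ?_ (h'.trans ?_)
  · simp
  · refine congrArg Multiset.sum (Multiset.map_congr rfl fun z hz => ?_)
    have hz0 := (roots_derivPoly k z hz).1
    simp [Complex.normSq_apply, hz0, sq]

lemma hasDerivAt_multiset_sum {x : ℝ} (hx : x ∈ Set.Ioo 0 (Real.pi / 2)) (m : Multiset ℝ)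
    (hm : ∀ s ∈ m, s ^ 2 ≤ 1) :
    ∃ d, 0 ≤ d ∧ (0 ∈ m → 0 < d) ∧ HasDerivAt (fun x => (m.map fun s =>
      (Real.cos x ^ 2 + s ^ 2 * Real.sin x ^ 2)⁻¹).sum) d x := by
  have hs : 0 < Real.sin x := Real.sin_pos_of_pos_of_lt_pi hx.1 (by linarith [hx.2, Real.pi_pos])
  have hc : 0 < Real.cos x := Real.cos_pos_of_mem_Ioo ⟨by linarith [hx.1, Real.pi_pos], hx.2⟩
  induction m using Multiset.induction with
  | empty => exact ⟨0, le_rfl, by simp, by simpa using hasDerivAt_const x (0 : ℝ)⟩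
  | cons s m ih =>
    obtain ⟨d, hd, hd', hder⟩ := ih fun t ht => hm t (Multiset.mem_cons_of_mem ht)
    have hs1 : s ^ 2 ≤ 1 := hm s (Multiset.mem_cons_self s m)
    set D := Real.cos x ^ 2 + s ^ 2 * Real.sin x ^ 2 with hD
    have hDpos : 0 < D := by positivity
    have hterm : HasDerivAt (fun x => (Real.cos x ^ 2 + s ^ 2 * Real.sin x ^ 2)⁻¹)
        (2 * Real.sin x * Real.cos x * (1 - s ^ 2) / D ^ 2) x := by
      have h1 := ((Real.hasDerivAt_cos x).fun_pow 2).fun_add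
        (((Real.hasDerivAt_sin x).fun_pow 2).const_mul (s ^ 2))
      refine (h1.fun_inv hDpos.ne').congr_deriv ?_
      rw [← hD]
      congr 1
      push_cast
      ring
    have hnn : 0 ≤ 2 * Real.sin x * Real.cos x * (1 - s ^ 2) / D ^ 2 := by
      have : 0 ≤ 1 - s ^ 2 := by linarith
      positivity
    refine ⟨2 * Real.sin x * Real.cos x * (1 - s ^ 2) / D ^ 2 + d, by positivity, ?_, ?_⟩
    · intro h0
      rcases Multiset.mem_cons.mp h0 with rfl | h0
      · refine add_pos_of_pos_of_nonneg ?_ hd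
        rw [zero_pow two_ne_zero, sub_zero]
        positivity
      · exact add_pos_of_nonneg_of_pos hnn (hd' h0)
    · simpa using hterm.fun_add hder

/-- The lattice sum `∑_{j∈ℤ} (θ+2πj)^{-k}`. -/
noncomputable def latticeSum (k : ℕ) (θ : ℝ) : ℝ :=
  ∑' j : ℤ, ((θ + 2 * Real.pi * (j : ℝ)) ^ k)⁻¹

lemma le_abs_add_two_pi_mul {a t : ℝ} (ha : 0 < a) (ht : t ∈ Set.Ioo a Real.pi) (j : ℤ) :
    a / 2 * (1 + |(j : ℝ)|) ≤ |t + 2 * Real.pi * j| := by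
  obtain ⟨h1, h2⟩ := ht
  rcases le_or_gt 0 j with hj | hj
  · have hj' : (0 : ℝ) ≤ j := by exact_mod_cast hj
    rw [abs_of_nonneg hj']
    refine le_trans ?_ (le_abs_self _)
    nlinarith
  · have hj' : (j : ℝ) ≤ -1 := by exact_mod_cast (by omega : j ≤ -1)
    rw [abs_of_nonpos (by linarith)]
    refine le_trans ?_ (neg_le_abs _)
    nlinarith

lemma add_two_pi_mul_ne_zero {t : ℝ} (ht : t ∈ Set.Ioo 0 Real.pi) (j : ℤ) :
    t + 2 * Real.pi * j ≠ 0 := by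
  have := le_abs_add_two_pi_mul (a := t / 2) (by linarith [ht.1]) ⟨by linarith [ht.1], ht.2⟩ j
  rw [← abs_pos]
  refine lt_of_lt_of_le ?_ this
  have := ht.1
  positivity

lemma summable_bound {k : ℕ} (hk : 2 ≤ k) (b : ℝ) :
    Summable fun j : ℤ => ((b * (1 + |(j : ℝ)|)) ^ k)⁻¹ := by
  have h : Summable fun n : ℕ => ((1 + (n : ℝ)) ^ k)⁻¹ := by
    have := (summable_nat_add_iff 1).mpr (Real.summable_nat_pow_inv.mpr (by omega : 1 < k))
    refine this.congr fun n => ?_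
    push_cast
    rw [add_comm]
  have h' : Summable fun j : ℤ => ((1 + |(j : ℝ)|) ^ k)⁻¹ := by
    refine Summable.of_nat_of_neg ?_ ?_ <;> simpa using h
  simpa only [mul_pow, mul_inv] using h'.mul_left (b ^ k)⁻¹

lemma norm_inv_pow_le {a t : ℝ} (ha : 0 < a) (ht : t ∈ Set.Ioo a Real.pi) (j : ℤ) (k : ℕ) :
    ‖((t + 2 * Real.pi * j) ^ k)⁻¹‖ ≤ ((a / 2 * (1 + |(j : ℝ)|)) ^ k)⁻¹ := by
  rw [norm_inv, norm_pow, Real.norm_eq_abs]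
  gcongr
  exact le_abs_add_two_pi_mul ha ht j

lemma summable_latticeSum {k : ℕ} (hk : 2 ≤ k) {t : ℝ} (ht : t ∈ Set.Ioo 0 Real.pi) :
    Summable fun j : ℤ => ((t + 2 * Real.pi * (j : ℝ)) ^ k)⁻¹ := by
  have h0 := ht.1
  exact Summable.of_norm_bounded (summable_bound hk (t / 2 / 2)) fun j =>
    norm_inv_pow_le (by positivity) ⟨by linarith, ht.2⟩ j k

lemma hasDerivAt_inv_pow_add (k : ℕ) {t b : ℝ} (h : t + b ≠ 0) :
    HasDerivAt (fun t => ((t + b) ^ k)⁻¹) (-k * ((t + b) ^ (k + 1))⁻¹) t := by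
  refine (((((hasDerivAt_id t).add_const b).fun_pow k).fun_inv (pow_ne_zero k h))).congr_deriv ?_
  rcases k with _ | k
  · simp
  · simp only [id, Nat.add_sub_cancel]
    field_simp
    ring

lemma hasDerivAt_inv_add {t b : ℝ} (h : t + b ≠ 0) :
    HasDerivAt (fun t => (t + b)⁻¹) (-((t + b) ^ 2)⁻¹) t := by
  simpa using hasDerivAt_inv_pow_add 1 h

lemma hasDerivAt_latticeSum {k : ℕ} (hk : 2 ≤ k) {θ : ℝ} (hθ : θ ∈ Set.Ioo 0 Real.pi) :
    HasDerivAt (latticeSum k) (-k * latticeSum (k + 1) θ) θ := by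
  have h0 := hθ.1
  have ha : 0 < θ / 2 := by positivity
  have hmem : θ ∈ Set.Ioo (θ / 2) Real.pi := ⟨by linarith, hθ.2⟩
  have := hasDerivAt_tsum_of_isPreconnected (𝕜 := ℝ)
    (g := fun (j : ℤ) t => ((t + 2 * Real.pi * (j : ℝ)) ^ k)⁻¹)
    (g' := fun (j : ℤ) t => -k * ((t + 2 * Real.pi * (j : ℝ)) ^ (k + 1))⁻¹)
    ((summable_bound (by omega : 2 ≤ k + 1) (θ / 2 / 2)).mul_left (k : ℝ))
    isOpen_Ioo isPreconnected_Ioo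
    (fun j t ht => hasDerivAt_inv_pow_add k
      (add_two_pi_mul_ne_zero ⟨ha.trans ht.1, ht.2⟩ j))
    (fun j t ht => ?_) hmem (summable_latticeSum hk hθ) hmem
  · rwa [tsum_mul_left] at this
  · rw [norm_mul, norm_neg, Real.norm_natCast]
    exact mul_le_mul_of_nonneg_left (norm_inv_pow_le ha ht j (k + 1)) (Nat.cast_nonneg k)

lemma hasDerivAt_cot {x : ℝ} (hx : Real.sin x ≠ 0) :
    HasDerivAt Real.cot (-(1 + Real.cot x ^ 2)) x := by
  have h := (Real.hasDerivAt_cos x).fun_div (Real.hasDerivAt_sin x) hx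
  have e : Real.cot = fun x => Real.cos x / Real.sin x := funext Real.cot_eq_cos_div_sin
  rw [e]
  refine h.congr_deriv ?_
  field_simp
  ring

lemma hasDerivAt_cot_half {θ : ℝ} (hθ : θ ∈ Set.Ioo 0 Real.pi) :
    HasDerivAt (fun t => Real.cot (t / 2)) (-(1 + Real.cot (θ / 2) ^ 2) / 2) θ := by
  have hs : Real.sin (θ / 2) ≠ 0 :=
    (Real.sin_pos_of_pos_of_lt_pi (by linarith [hθ.1]) (by linarith [hθ.1, hθ.2])).ne'
  refine ((hasDerivAt_cot hs).comp θ ((hasDerivAt_id θ).div_const 2)).congr_deriv ?_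
  ring

lemma cot_half_eq_tsum {θ : ℝ} (hθ : θ ∈ Set.Ioo 0 Real.pi) :
    Real.cot (θ / 2) / 2 = (θ + 2 * Real.pi * (0 : ℤ))⁻¹ +
      ∑' n : ℕ, ((θ + 2 * Real.pi * ((n + 1 : ℤ) : ℝ))⁻¹ +
        (θ + 2 * Real.pi * ((-(n + 1) : ℤ) : ℝ))⁻¹) := by
  have hpi := Real.pi_pos
  have hu : ((θ / (2 * Real.pi) : ℝ) : ℂ) ∈ Complex.integerComplement := by
    rw [Complex.mem_integerComplement_iff]
    rintro ⟨n, hn⟩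
    have hn' : (n : ℝ) = θ / (2 * Real.pi) := by exact_mod_cast hn
    rw [eq_div_iff (by positivity)] at hn'
    apply add_two_pi_mul_ne_zero hθ (-n)
    push_cast
    linarith
  have h := cot_series_rep' hu
  rw [← Complex.ofReal_mul, ← Complex.ofReal_cot] at h
  have h' : Real.pi * Real.cot (Real.pi * (θ / (2 * Real.pi))) - 1 / (θ / (2 * Real.pi)) =
      ∑' n : ℕ, (1 / (θ / (2 * Real.pi) - (n + 1)) + 1 / (θ / (2 * Real.pi) + (n + 1))) := by
    exact_mod_cast h
  have e : Real.pi * (θ / (2 * Real.pi)) = θ / 2 := by field_simp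
  rw [e] at h'
  have h2 : ∑' n : ℕ, (1 / (θ / (2 * Real.pi) - (n + 1)) + 1 / (θ / (2 * Real.pi) + (n + 1))) =
      2 * Real.pi * ∑' n : ℕ, ((θ + 2 * Real.pi * ((n + 1 : ℤ) : ℝ))⁻¹ +
        (θ + 2 * Real.pi * ((-(n + 1) : ℤ) : ℝ))⁻¹) := by
    rw [← tsum_mul_left]
    refine tsum_congr fun n => ?_
    have e1 : θ + 2 * Real.pi * ((n + 1 : ℤ) : ℝ) =
        2 * Real.pi * (θ / (2 * Real.pi) + (n + 1)) := by
      push_cast; field_simp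
    have e2 : θ + 2 * Real.pi * ((-(n + 1) : ℤ) : ℝ) =
        2 * Real.pi * (θ / (2 * Real.pi) - (n + 1)) := by
      push_cast; field_simp; ring
    rw [e1, e2, mul_inv, mul_inv]
    field_simp
    ring
  rw [h2] at h'
  have h0 := hθ.1.ne'
  simp only [Int.cast_zero, mul_zero, add_zero]
  field_simp at h' ⊢
  linarith

lemma summable_inv_add_inv {θ : ℝ} (hθ : θ ∈ Set.Ioo 0 Real.pi) :
    Summable fun n : ℕ => (θ + 2 * Real.pi * ((n + 1 : ℤ) : ℝ))⁻¹ +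
      (θ + 2 * Real.pi * ((-(n + 1) : ℤ) : ℝ))⁻¹ := by
  have h0 := hθ.1
  have ha : 0 < θ / 2 := by positivity
  have hmem : θ ∈ Set.Ioo (θ / 2) Real.pi := ⟨by linarith, hθ.2⟩
  have inj : Function.Injective (fun n : ℕ => (n + 1 : ℤ)) := fun a b h => by simpa using h
  refine Summable.of_norm_bounded
    (((summable_bound le_rfl (θ / 2 / 2)).comp_injective inj).mul_left (2 * θ)) fun n => ?_
  have e : (θ + 2 * Real.pi * ((n + 1 : ℤ) : ℝ))⁻¹ + (θ + 2 * Real.pi * ((-(n + 1) : ℤ) : ℝ))⁻¹ =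
      2 * θ * ((θ + 2 * Real.pi * ((n + 1 : ℤ) : ℝ))⁻¹ *
        (θ + 2 * Real.pi * ((-(n + 1) : ℤ) : ℝ))⁻¹) := by
    rw [inv_add_inv (add_two_pi_mul_ne_zero hθ _) (add_two_pi_mul_ne_zero hθ _), ← mul_inv,
      div_eq_mul_inv]
    push_cast
    ring
  have b1 := norm_inv_pow_le ha hmem (n + 1) 1
  have b2 := norm_inv_pow_le ha hmem (-(n + 1)) 1
  rw [Int.cast_neg (n + 1 : ℤ), abs_neg, ← Int.cast_neg] at b2
  rw [pow_one, pow_one] at b1 b2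
  rw [e, norm_mul, Real.norm_of_nonneg (by positivity : 0 ≤ 2 * θ), norm_mul]
  simp only [Function.comp_apply]
  rw [sq, mul_inv]
  exact mul_le_mul_of_nonneg_left
    (mul_le_mul b1 b2 (norm_nonneg _) ((norm_nonneg _).trans b1)) (by positivity)

lemma hasDerivAt_tsum_inv_add_inv {θ : ℝ} (hθ : θ ∈ Set.Ioo 0 Real.pi) :
    HasDerivAt (fun t => ∑' n : ℕ, ((t + 2 * Real.pi * ((n + 1 : ℤ) : ℝ))⁻¹ +
        (t + 2 * Real.pi * ((-(n + 1) : ℤ) : ℝ))⁻¹))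
      (∑' n : ℕ, (-((θ + 2 * Real.pi * ((n + 1 : ℤ) : ℝ)) ^ 2)⁻¹ +
        -((θ + 2 * Real.pi * ((-(n + 1) : ℤ) : ℝ)) ^ 2)⁻¹)) θ := by
  have h0 := hθ.1
  have ha : 0 < θ / 2 := by positivity
  have hmem : θ ∈ Set.Ioo (θ / 2) Real.pi := ⟨by linarith, hθ.2⟩
  have hb := summable_bound le_rfl (θ / 2 / 2)
  have inj1 : Function.Injective (fun n : ℕ => (n + 1 : ℤ)) := fun a b h => by simpa using h
  have inj2 : Function.Injective (fun n : ℕ => (-(n + 1) : ℤ)) := fun a b h => by simpa using h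
  have hd : ∀ (j : ℤ) t, t ∈ Set.Ioo (θ / 2) Real.pi →
      HasDerivAt (fun t => (t + 2 * Real.pi * (j : ℝ))⁻¹)
        (-((t + 2 * Real.pi * (j : ℝ)) ^ 2)⁻¹) t := fun j t ht =>
    hasDerivAt_inv_add (add_two_pi_mul_ne_zero ⟨ha.trans ht.1, ht.2⟩ j)
  have hbn : ∀ (j : ℤ) t, t ∈ Set.Ioo (θ / 2) Real.pi →
      ‖-((t + 2 * Real.pi * (j : ℝ)) ^ 2)⁻¹‖ ≤ ((θ / 2 / 2 * (1 + |(j : ℝ)|)) ^ 2)⁻¹ := by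
    intro j t ht
    rw [norm_neg]
    exact norm_inv_pow_le ha ht j 2
  exact hasDerivAt_tsum_of_isPreconnected (𝕜 := ℝ)
    ((hb.comp_injective inj1).add (hb.comp_injective inj2)) isOpen_Ioo isPreconnected_Ioo
    (fun n t ht => (hd (n + 1) t ht).fun_add (hd (-(n + 1)) t ht))
    (fun n t ht => (norm_add_le _ _).trans (add_le_add (hbn (n + 1) t ht) (hbn (-(n + 1)) t ht)))
    hmem (summable_inv_add_inv hθ) hmem

lemma latticeSum_two {θ : ℝ} (hθ : θ ∈ Set.Ioo 0 Real.pi) :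
    latticeSum 2 θ * 4 = 1 + Real.cot (θ / 2) ^ 2 := by
  have hE := (hasDerivAt_inv_add (add_two_pi_mul_ne_zero hθ 0)).fun_add
    (hasDerivAt_tsum_inv_add_inv hθ)
  have hF := hE.congr_of_eventuallyEq (Filter.eventuallyEq_of_mem (isOpen_Ioo.mem_nhds hθ)
      fun t ht => cot_half_eq_tsum ht)
  have hG := hF.unique ((hasDerivAt_cot_half hθ).div_const 2)
  have hs := summable_latticeSum le_rfl hθ
  have hs1 : Summable fun n : ℕ => ((θ + 2 * Real.pi * ((n + 1 : ℤ) : ℝ)) ^ 2)⁻¹ :=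
    hs.comp_injective (i := fun n : ℕ => (n + 1 : ℤ)) fun a b h => by simpa using h
  have hs2 : Summable fun n : ℕ => ((θ + 2 * Real.pi * ((-(n + 1) : ℤ) : ℝ)) ^ 2)⁻¹ :=
    hs.comp_injective (i := fun n : ℕ => (-(n + 1) : ℤ)) fun a b h => by simpa using h
  have hT := tsum_of_add_one_of_neg_add_one
    (f := fun j : ℤ => ((θ + 2 * Real.pi * (j : ℝ)) ^ 2)⁻¹) hs1 hs2
  rw [Summable.tsum_add hs1.neg hs2.neg, tsum_neg, tsum_neg] at hG
  rw [latticeSum, hT]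
  linarith

open Polynomial in
lemma latticeSum_eq_eval_derivPoly {k : ℕ} (hk : 1 ≤ k) :
    ∀ θ ∈ Set.Ioo 0 Real.pi, latticeSum (k + 1) θ * (k.factorial * 2 ^ (k + 1)) =
      (derivPoly k).eval (Real.cot (θ / 2)) := by
  induction k, hk using Nat.le_induction with
  | base =>
    intro θ hθ
    have := latticeSum_two hθ
    simp [derivPoly]
    linarith
  | succ k hk ih =>
    intro θ hθ
    have h1 := (hasDerivAt_latticeSum (by omega : 2 ≤ k + 1) hθ).mul_const
      ((k.factorial : ℝ) * 2 ^ (k + 1))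
    have h2 := ((derivPoly k).hasDerivAt (Real.cot (θ / 2))).comp θ (hasDerivAt_cot_half hθ)
    have h3 := (h2.congr_of_eventuallyEq (Filter.eventuallyEq_of_mem (isOpen_Ioo.mem_nhds hθ)
      fun t ht => ih t ht)).unique h1
    simp only [derivPoly, eval_mul, eval_add, eval_one, eval_pow, eval_X, Nat.factorial_succ]
    push_cast at h3 ⊢
    rw [pow_succ]
    linear_combination 2 * h3

lemma sin_cos_half_pos {θ : ℝ} (hθ : θ ∈ Set.Ioo 0 Real.pi) :
    0 < Real.sin (θ / 2) ∧ 0 < Real.cos (θ / 2) :=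
  ⟨Real.sin_pos_of_pos_of_lt_pi (by linarith [hθ.1]) (by linarith [hθ.1, hθ.2]),
    Real.cos_pos_of_mem_Ioo ⟨by linarith [hθ.1, hθ.2], by linarith [hθ.2]⟩⟩

/-- The sum `∑ₛ (cos² x + s² sin² x)⁻¹` over the imaginary parts `s` of the roots of
`derivPoly k`. -/
noncomputable def rootSum (k : ℕ) (x : ℝ) : ℝ :=
  ((imagRoots k).map fun s => (Real.cos x ^ 2 + s ^ 2 * Real.sin x ^ 2)⁻¹).sum

open Polynomial in
lemma eval_derivPoly_succ_cot (k : ℕ) {θ : ℝ} (hθ : θ ∈ Set.Ioo 0 Real.pi) :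
    (derivPoly (k + 1)).eval (Real.cot (θ / 2)) =
      rootSum k (θ / 2) * Real.cot (θ / 2) * (derivPoly k).eval (Real.cot (θ / 2)) := by
  obtain ⟨hs, hc⟩ := sin_cos_half_pos hθ
  have hcot : 0 < Real.cot (θ / 2) := by
    rw [Real.cot_eq_cos_div_sin]
    positivity
  have h := logDeriv_derivPoly k hcot
  rw [div_eq_iff (eval_derivPoly_ne_zero k hcot)] at h
  simp only [derivPoly, eval_mul, eval_add, eval_one, eval_pow, eval_X]
  rw [h, ← mul_assoc]
  congr 1
  rw [rootSum, ← Multiset.sum_map_mul_left, ← Multiset.sum_map_mul_right]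
  congr 1
  refine Multiset.map_congr rfl fun s _ => ?_
  rw [Real.cot_eq_cos_div_sin]
  have h1 := Real.sin_sq_add_cos_sq (θ / 2)
  have h2 : 0 < Real.cos (θ / 2) ^ 2 + s ^ 2 * Real.sin (θ / 2) ^ 2 := by positivity
  field_simp
  linear_combination h1

lemma rootSum_pos (p : ℕ) {x : ℝ} (hx : 0 < Real.cos x) : 0 < rootSum (2 * p) x := by
  obtain ⟨m, hm⟩ := Multiset.exists_cons_of_mem (zero_mem_imagRoots p)
  rw [rootSum, hm, Multiset.map_cons, Multiset.sum_cons]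
  refine add_pos_of_pos_of_nonneg (by positivity) (Multiset.sum_nonneg fun y hy => ?_)
  obtain ⟨s, -, rfl⟩ := Multiset.mem_map.mp hy
  positivity

lemma deriv_Cp_div_Mp {p : ℕ} (hp : 1 ≤ p) {θ : ℝ} (hθ : θ ∈ Set.Ioo 0 Real.pi) :
    deriv (Cp p) θ / Mp p θ =
      (2 * p + 1) - 2 * (2 * p + 1) * (p + 1) / rootSum (2 * p) (θ / 2) := by
  obtain ⟨hs, hc⟩ := sin_cos_half_pos hθ
  have hcot : 0 < Real.cot (θ / 2) := by
    rw [Real.cot_eq_cos_div_sin]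
    positivity
  have hF := rootSum_pos p hc
  have h1 := latticeSum_eq_eval_derivPoly (by omega : 1 ≤ 2 * p) θ hθ
  have h2 := latticeSum_eq_eval_derivPoly (by omega : 1 ≤ 2 * p + 1) θ hθ
  rw [eval_derivPoly_succ_cot _ hθ, ← h1, Nat.factorial_succ, pow_succ _ (2 * p + 1)] at h2
  have hne : latticeSum (2 * p + 1) θ ≠ 0 := by
    intro h
    rw [h, zero_mul] at h1
    exact eval_derivPoly_ne_zero _ hcot h1.symm
  have hfac : ((2 * p).factorial : ℝ) * 2 ^ (2 * p + 1) ≠ 0 := by positivity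
  have h3 : latticeSum (2 * p + 2) θ * (2 * (2 * p + 1)) =
      rootSum (2 * p) (θ / 2) * Real.cot (θ / 2) * latticeSum (2 * p + 1) θ := by
    apply mul_right_cancel₀ hfac
    push_cast at h2
    linear_combination h2
  have hg : 2 - 2 * Real.cos θ = 4 * Real.sin (θ / 2) ^ 2 := by
    have := Real.cos_two_mul (θ / 2)
    rw [mul_div_cancel₀ _ two_ne_zero] at this
    linarith [Real.sin_sq_add_cos_sq (θ / 2)]
  have hsin : Real.sin θ = 2 * Real.sin (θ / 2) * Real.cos (θ / 2) := by
    rw [← Real.sin_two_mul, mul_div_cancel₀ _ two_ne_zero]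
  have hd : HasDerivAt (Cp p) (-((p + 1) * (2 - 2 * Real.cos θ) ^ p * (2 * Real.sin θ)) *
      latticeSum (2 * p + 1) θ + -(2 - 2 * Real.cos θ) ^ (p + 1) *
      (-(2 * p + 1) * latticeSum (2 * p + 2) θ)) θ := by
    have hA := ((((Real.hasDerivAt_cos θ).const_mul 2).const_sub 2).fun_pow (p + 1)).fun_neg.fun_mul
      (hasDerivAt_latticeSum (by omega : 2 ≤ 2 * p + 1) hθ)
    refine hA.congr_deriv ?_
    simp
  rw [hd.deriv]
  change _ / ((2 - 2 * Real.cos θ) ^ (p + 1) * latticeSum (2 * p + 2) θ) = _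
  have h4 : latticeSum (2 * p + 2) θ = rootSum (2 * p) (θ / 2) * Real.cot (θ / 2) *
      latticeSum (2 * p + 1) θ / (2 * (2 * p + 1)) := by
    rw [eq_div_iff (by positivity), h3]
  rw [h4, hg, hsin, Real.cot_eq_cos_div_sin]
  field_simp
  ring

/-- Lemma B.2: for every `p ≥ 1` and `θ ∈ (0,π)`, the function
`t ↦ C_p'(t)/M_p(t)` is differentiable at `θ` with strictly positive
derivative; in particular it is strictly increasing on `(0,π)`. -/
theorem lemma_B2 (p : ℕ) (hp : 1 ≤ p) :
    (∀ θ ∈ Set.Ioo (0 : ℝ) Real.pi,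
        DifferentiableAt ℝ (fun t : ℝ => deriv (Cp p) t / Mp p t) θ ∧
        0 < deriv (fun t : ℝ => deriv (Cp p) t / Mp p t) θ) ∧
    StrictMonoOn (fun t : ℝ => deriv (Cp p) t / Mp p t)
      (Set.Ioo (0 : ℝ) Real.pi) := by
  have key : ∀ θ ∈ Set.Ioo (0 : ℝ) Real.pi,
      ∃ d, 0 < d ∧ HasDerivAt (fun t : ℝ => deriv (Cp p) t / Mp p t) d θ := by
    intro θ hθ
    obtain ⟨d, -, hd, hder⟩ := hasDerivAt_multiset_sum (x := θ / 2)
      ⟨by linarith [hθ.1], by linarith [hθ.2]⟩ (imagRoots (2 * p))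
      fun s hs => sq_le_one_of_mem_imagRoots hs
    have hdpos := hd (zero_mem_imagRoots p)
    have hF := rootSum_pos p (sin_cos_half_pos hθ).2
    have h1 : HasDerivAt (fun t => rootSum (2 * p) (t / 2)) (d * (1 / 2)) θ :=
      HasDerivAt.comp (h₂ := rootSum (2 * p)) θ hder ((hasDerivAt_id θ).div_const 2)
    have h2 := ((h1.fun_inv hF.ne').const_mul (2 * (2 * p + 1) * (p + 1) : ℝ)).const_sub
      (2 * p + 1 : ℝ)
    refine ⟨_, ?_, h2.congr_of_eventuallyEq (Filter.eventuallyEq_of_mem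
      (isOpen_Ioo.mem_nhds hθ) fun t ht => ?_)⟩
    · rw [← mul_neg, neg_div, neg_neg]
      positivity
    · simp only [deriv_Cp_div_Mp hp ht, div_eq_mul_inv]
  have hpos : ∀ θ ∈ Set.Ioo (0 : ℝ) Real.pi,
      DifferentiableAt ℝ (fun t : ℝ => deriv (Cp p) t / Mp p t) θ ∧
        0 < deriv (fun t : ℝ => deriv (Cp p) t / Mp p t) θ := by
    intro θ hθ
    obtain ⟨d, hd, h⟩ := key θ hθ
    exact ⟨h.differentiableAt, h.deriv ▸ hd⟩
  refine ⟨hpos, strictMonoOn_of_deriv_pos (convex_Ioo _ _)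
    (fun θ hθ => (hpos θ hθ).1.continuousAt.continuousWithinAt) fun θ hθ => ?_⟩
  rw [interior_Ioo] at hθ
  exact (hpos θ hθ).2
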